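/- Let n, m, k be natural numbers with k ≤ m − n, let S be a finite nonempty family of n-element subsets of {1,…,m}, and let Λ₁ be a k×m matrix over ℚ such that for every σ ∈ S the k×(m−n) submatrix Λ₁(σ̄) has rank k, where σ̄ is the complement of σ in {1,…,m}. Then there exists an (m−n−k)×m matrix Λ₂ over ℚ such that for every σ ∈ S the (m−n)×(m−n) matrix obtained by stacking Λ₁(σ̄) on top of Λ₂(σ̄) has nonzero determinant. -/

import Mathlib

/-- The submatrix `A(τ)` of an `r × m` matrix `A` consisting of the columns indexed by the
`k`-element subset `τ ⊆ {1,…,m}`, the columns being taken in increasing order. -/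
noncomputable def colSub {r m k : ℕ} {α : Type*} (A : Matrix (Fin r) (Fin m) α)
    (τ : Finset (Fin m)) (h : τ.card = k) : Matrix (Fin r) (Fin k) α :=
  A.submatrix id (fun j => (τ.orderIsoOfFin h j : Fin m))

/-- Finitely many nonzero polynomials over an infinite domain have a common point at which none of
them vanishes. -/
theorem exists_forall_eval_ne_zero {R ι α : Type*} [CommRing R] [IsDomain R] [Infinite R]
    (s : Finset ι) (p : ι → MvPolynomial α R) (hp : ∀ i ∈ s, p i ≠ 0) :
    ∃ x : α → R, ∀ i ∈ s, MvPolynomial.eval x (p i) ≠ 0 := by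
  have hprod : ∏ i ∈ s, p i ≠ 0 := Finset.prod_ne_zero_iff.2 hp
  obtain ⟨x, hx⟩ : ∃ x, MvPolynomial.eval x (∏ i ∈ s, p i) ≠ 0 := by
    contrapose! hprod
    exact MvPolynomial.funext fun x => by simp [hprod x]
  rw [map_prod] at hx
  exact ⟨x, Finset.prod_ne_zero_iff.1 hx⟩

/-- A matrix of full row rank can be completed to an invertible square matrix. -/
theorem exists_det_fromRows_ne_zero {K κ ρ ι : Type*} [Field K] [Fintype κ] [Fintype ρ]
    [Fintype ι] [DecidableEq ι] (e : ι ≃ κ ⊕ ρ) (A : Matrix κ ι K)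
    (hA : A.rank = Fintype.card κ) :
    ∃ B : Matrix ρ ι K, ((Matrix.fromRows A B).submatrix e id).det ≠ 0 := by
  have hli : LinearIndependent K A.row := by
    rw [linearIndependent_iff_card_eq_finrank_span, Set.finrank, ← Matrix.rank_eq_finrank_span_row,
      hA]
  obtain ⟨W, hW⟩ := Submodule.exists_isCompl (Submodule.span K (Set.range A.row))
  have hdim : Module.finrank K W = Fintype.card ρ := by
    have h1 := Submodule.finrank_add_eq_of_isCompl hW
    rw [← Matrix.rank_eq_finrank_span_row, hA, Module.finrank_fintype_fun_eq_card,
      Fintype.card_congr e, Fintype.card_sum] at h1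
    omega
  let b : Module.Basis ρ K W :=
    (Module.finBasisOfFinrankEq K W hdim).reindex (Fintype.equivFin ρ).symm
  let B : Matrix ρ ι K := Matrix.of fun i => (b i : ι → K)
  have hB : LinearIndependent K B.row :=
    b.linearIndependent.map' W.subtype W.ker_subtype
  have hBW : Submodule.span K (Set.range B.row) ≤ W := by
    rw [Submodule.span_le]
    rintro _ ⟨i, rfl⟩
    exact (b i).2
  have hrows : LinearIndependent K ((Matrix.fromRows A B).submatrix e id).row := by
    have h := (hli.sum_type hB (hW.disjoint.mono_right hBW)).comp e e.injective
    have hrow : ((Matrix.fromRows A B).submatrix e id).row = Sum.elim A.row B.row ∘ e := by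
      funext i j
      simp only [Matrix.row, Matrix.submatrix_apply, Function.comp_apply, id]
      cases e i <;> rfl
    rwa [hrow]
  refine ⟨B, IsUnit.ne_zero ?_⟩
  rwa [← Matrix.isUnit_iff_isUnit_det, ← Matrix.linearIndependent_rows_iff_isUnit]

/-- If the columns of `A` selected by `f` form a matrix of full row rank, then the determinant of
that matrix stacked on the same columns of a matrix `B` is a nonzero polynomial in the entries
of `B`. -/
theorem exists_polynomial_eval_eq_det_fromRows {K κ ρ ι μ : Type*} [Field K] [Fintype κ]
    [Fintype ρ] [Fintype ι] [DecidableEq ι] (e : ι ≃ κ ⊕ ρ) (f : ι → μ)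
    (hf : Function.Injective f) (A : Matrix κ μ K)
    (hA : (A.submatrix id f).rank = Fintype.card κ) :
    ∃ p : MvPolynomial (ρ × μ) K, p ≠ 0 ∧ ∀ x : ρ × μ → K, MvPolynomial.eval x p =
      ((Matrix.fromRows (A.submatrix id f)
        ((Matrix.of fun i j => x (i, j)).submatrix id f)).submatrix e id).det := by
  let P : Matrix ρ μ (MvPolynomial (ρ × μ) K) := Matrix.of fun i j => MvPolynomial.X (i, j)
  let p := ((Matrix.fromRows ((A.map MvPolynomial.C).submatrix id f)
    (P.submatrix id f)).submatrix e id).det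
  have hp : ∀ x : ρ × μ → K, MvPolynomial.eval x p =
      ((Matrix.fromRows (A.submatrix id f)
        ((Matrix.of fun i j => x (i, j)).submatrix id f)).submatrix e id).det := by
    intro x
    rw [RingHom.map_det]
    congr 1
    ext i j
    simp only [RingHom.mapMatrix_apply, Matrix.map_apply, Matrix.submatrix_apply]
    cases e i <;> simp [P]
  refine ⟨p, fun h0 => ?_, hp⟩
  obtain ⟨B, hB⟩ := exists_det_fromRows_ne_zero e _ hA
  have h := hp fun ij => Function.extend f (B ij.1) 0 ij.2
  rw [h0, map_zero] at h
  apply hB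
  rw [h]
  congr 3
  ext i j
  simp [hf.extend_apply]

/-- Lemma 4.5 (key step of Lemma "extension"): given `k ≤ m - n`, a finite nonempty family
`S` of `n`-element subsets of `{1,…,m}`, and a `k × m` rational matrix `Λ₁` such that
`Λ₁(σ̄)` has rank `k` for every `σ ∈ S`, there exists an `(m-n-k) × m` rational matrix `Λ₂`
such that for every `σ ∈ S` the `(m-n) × (m-n)` matrix obtained by stacking `Λ₁(σ̄)` on top
of `Λ₂(σ̄)` has nonzero determinant. -/
theorem stmt3 {n m k : ℕ} (hk : k ≤ m - n)
    (S : Finset (Finset (Fin m))) (hS : S.Nonempty)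
    (hcard : ∀ σ ∈ S, σ.card = n)
    (Λ₁ : Matrix (Fin k) (Fin m) ℚ)
    (hrank : ∀ σ ∈ S, ∀ h : σᶜ.card = m - n, (colSub Λ₁ σᶜ h).rank = k) :
    ∃ Λ₂ : Matrix (Fin (m - n - k)) (Fin m) ℚ,
      ∀ σ ∈ S, ∀ h : σᶜ.card = m - n,
        ((Matrix.fromRows (colSub Λ₁ σᶜ h) (colSub Λ₂ σᶜ h)).submatrix
          ((finCongr (Nat.add_sub_cancel' hk)).symm.trans finSumFinEquiv.symm) id).det ≠ 0 := by
  have hc : ∀ σ ∈ S, σᶜ.card = m - n := fun σ hσ => by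
    rw [Finset.card_compl, Fintype.card_fin, hcard σ hσ]
  have hpoly := fun σ : S => exists_polynomial_eval_eq_det_fromRows
    ((finCongr (Nat.add_sub_cancel' hk)).symm.trans finSumFinEquiv.symm)
    (fun j => (σ.1ᶜ.orderIsoOfFin (hc σ σ.2) j : Fin m))
    (Subtype.val_injective.comp (OrderIso.injective _)) Λ₁
    ((hrank σ σ.2 (hc σ σ.2)).trans (Fintype.card_fin k).symm)
  choose p hp0 hp using hpoly
  obtain ⟨x, hx⟩ := exists_forall_eval_ne_zero Finset.univ p fun σ _ => hp0 σ
  refine ⟨Matrix.of fun i j => x (i, j), fun σ hσ h => ?_⟩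
  have hne := hx ⟨σ, hσ⟩ (Finset.mem_univ _)
  rw [hp] at hne
  exact hne
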